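/- arXiv:2605.07520 — 2 statements merged into one kernel-verified Lean document; each statement's English description precedes it below -/
import Mathlib

section
/- For every timestep t ≤ H, the derivative of the state with respect to the parameters admits the closed-form expression D_θ s_t = Σ_{τ=0}^{t−1} ( Π_{j=τ+1}^{t−1} ( ∂_s f(s_j(θ), ã_j(θ)) + ∂_a f(s_j(θ), ã_j(θ)) ∘ ∂_s π(θ, s_j(θ)) ) ) ∘ ∂_a f(s_τ(θ), ã_τ(θ)) ∘ ∂_θ π(θ, s_τ(θ)), where the product of continuous linear maps is composed in order of decreasing index j (from j = t−1 on the left down to j = τ+1 on the right) and an empty product equals the identity map; in particular D_θ s_0 = 0. -/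
/-- Ordered product of continuous linear maps: `prodDesc M a n = M (a+n-1) ∘ ⋯ ∘ M (a+1) ∘ M a`,
i.e. the composition of the maps `M j` for `j` ranging over `[a, a+n)`, composed in order of
decreasing index (largest index on the left); the empty product (`n = 0`) is the identity. -/
def prodDesc {S : Type*} [NormedAddCommGroup S] [NormedSpace ℝ S]
    (M : ℕ → S →L[ℝ] S) (a : ℕ) : ℕ → (S →L[ℝ] S)
  | 0 => ContinuousLinearMap.id ℝ S
  | n + 1 => (M (a + n)).comp (prodDesc M a n)

/-- One-step recursion for the sum of propagated sensitivities. -/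
theorem sum_prodDesc_comp_succ {S Θ : Type*}
    [NormedAddCommGroup S] [NormedSpace ℝ S] [NormedAddCommGroup Θ] [NormedSpace ℝ Θ]
    (M : ℕ → S →L[ℝ] S) (B : ℕ → Θ →L[ℝ] S) (t : ℕ) :
    ∑ τ ∈ Finset.range (t + 1), (prodDesc M (τ + 1) (t + 1 - 1 - τ)).comp (B τ) =
      (M t).comp (∑ τ ∈ Finset.range t, (prodDesc M (τ + 1) (t - 1 - τ)).comp (B τ)) + B t := by
  rw [Finset.sum_range_succ, ContinuousLinearMap.comp_finsetSum]
  congr 1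
  · refine Finset.sum_congr rfl fun τ hτ => ?_
    have hτ' := Finset.mem_range.mp hτ
    have hlen : t + 1 - 1 - τ = (t - 1 - τ) + 1 := by omega
    have hidx : τ + 1 + (t - 1 - τ) = t := by omega
    rw [hlen, prodDesc, hidx, ContinuousLinearMap.comp_assoc]
  · simp [prodDesc]

/-- Chain rule for `θ ↦ f (u θ, v θ)` in terms of the partial derivatives of `f`. -/
theorem DifferentiableAt.hasFDerivAt_comp_prodMk {E F G K : Type*}
    [NormedAddCommGroup E] [NormedSpace ℝ E] [NormedAddCommGroup F] [NormedSpace ℝ F]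
    [NormedAddCommGroup G] [NormedSpace ℝ G] [NormedAddCommGroup K] [NormedSpace ℝ K]
    {f : F × G → K} {u : E → F} {v : E → G} {u' : E →L[ℝ] F} {v' : E →L[ℝ] G} {x : E}
    (hf : DifferentiableAt ℝ f (u x, v x)) (hu : HasFDerivAt u u' x) (hv : HasFDerivAt v v' x) :
    HasFDerivAt (fun y => f (u y, v y))
      ((fderiv ℝ (fun a => f (a, v x)) (u x)).comp u' +
        (fderiv ℝ (fun b => f (u x, b)) (v x)).comp v') x := by
  have h := hf.hasFDerivAt.comp x (hu.prodMk hv)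
  have h₁ : HasFDerivAt (fun a => f (a, v x)) _ (u x) :=
    hf.hasFDerivAt.comp (u x) (hasFDerivAt_prodMk_left (𝕜 := ℝ) (u x) (v x))
  have h₂ : HasFDerivAt (fun b => f (u x, b)) _ (v x) :=
    hf.hasFDerivAt.comp (v x) (hasFDerivAt_prodMk_right (𝕜 := ℝ) (u x) (v x))
  rw [h₁.fderiv, h₂.fderiv]
  refine h.congr_fderiv ?_
  ext y
  simp [← map_add]

/-- Closed-form expression for the parameter-sensitivity of the state:
for every `t ≤ H`,
`D_θ s_t = Σ_{τ=0}^{t−1} (Π_{j=τ+1}^{t−1} (∂_s f_j + ∂_a f_j ∘ ∂_s π_j)) ∘ ∂_a f_τ ∘ ∂_θ π_τ`,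
where the product is composed in order of decreasing index `j` and the empty product is the
identity; in particular `D_θ s_0 = 0`. -/
theorem stmt1
    {S A Θ : Type*}
    [NormedAddCommGroup S] [NormedSpace ℝ S]
    [NormedAddCommGroup A] [NormedSpace ℝ A]
    [NormedAddCommGroup Θ] [NormedSpace ℝ Θ]
    (H : ℕ) (f : S × A → S) (pol : Θ × S → A)
    (hf : Differentiable ℝ f) (hpol : Differentiable ℝ pol)
    (ε : ℕ → A) (s₀ : S)
    (s : ℕ → Θ → S) (atil : ℕ → Θ → A)
    (hs0 : ∀ θ : Θ, s 0 θ = s₀)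
    (hatil : ∀ t : ℕ, ∀ θ : Θ, atil t θ = pol (θ, s t θ) + ε t)
    (hrec : ∀ t < H, ∀ θ : Θ, s (t + 1) θ = f (s t θ, atil t θ)) :
    (∀ t ≤ H, ∀ θ : Θ,
      fderiv ℝ (s t) θ =
        ∑ τ ∈ Finset.range t,
          (prodDesc
              (fun j : ℕ =>
                fderiv ℝ (fun x : S => f (x, atil j θ)) (s j θ)
                  + (fderiv ℝ (fun b : A => f (s j θ, b)) (atil j θ)).comp
                      (fderiv ℝ (fun x : S => pol (θ, x)) (s j θ)))
              (τ + 1) (t - 1 - τ)).comp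
            ((fderiv ℝ (fun b : A => f (s τ θ, b)) (atil τ θ)).comp
              (fderiv ℝ (fun p : Θ => pol (p, s τ θ)) θ))) ∧
    (∀ θ : Θ, fderiv ℝ (s 0) θ = 0) := by
  have hs0' : s 0 = fun _ => s₀ := funext hs0
  refine ⟨fun t ht θ => HasFDerivAt.fderiv ?_, fun θ => by simp [hs0']⟩
  induction t with
  | zero => simpa [hs0'] using hasFDerivAt_const s₀ θ
  | succ t ih =>
    have hs := ih (by omega)
    rw [sum_prodDesc_comp_succ]
    have ha := (DifferentiableAt.hasFDerivAt_comp_prodMk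
      (hpol (θ, s t θ)) (hasFDerivAt_id θ) hs).add_const (ε t)
    simp only [id] at ha
    rw [← funext (hatil t)] at ha
    rw [funext (hrec t (by omega))]
    convert DifferentiableAt.hasFDerivAt_comp_prodMk (hf (s t θ, atil t θ)) hs ha using 1
    simp only [ContinuousLinearMap.add_comp, ContinuousLinearMap.comp_add,
      ContinuousLinearMap.comp_id, ContinuousLinearMap.comp_assoc]
    abel
end

section
/- (Full expansion of the return gradient in terms of system Jacobians.) The Fréchet derivative of the total return R(θ) = Σ_{t=0}^{H−1} r(s_t(θ), ã_t(θ)) equals D_θ R(θ) = Σ_{t=0}^{H−1} [ ∂_a r(s_t(θ), ã_t(θ)) ∘ ∂_θ π(θ, s_t(θ)) + ( ∂_s r(s_t(θ), ã_t(θ)) + ∂_a r(s_t(θ), ã_t(θ)) ∘ ∂_s π(θ, s_t(θ)) ) ∘ Σ_{τ=0}^{t−1} ( Π_{j=τ+1}^{t−1} ( ∂_s f(s_j(θ), ã_j(θ)) + ∂_a f(s_j(θ), ã_j(θ)) ∘ ∂_s π(θ, s_j(θ)) ) ) ∘ ∂_a f(s_τ(θ), ã_τ(θ)) ∘ ∂_θ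 π(θ, s_τ(θ)) ], where the product of continuous linear maps is composed in order of decreasing index j and an empty product equals the identity. -/
/-- Chain rule for a function of two variables, in terms of its partial derivatives. -/
theorem hasFDerivAt_comp_prodMk_partial {E F G X : Type*}
    [NormedAddCommGroup E] [NormedSpace ℝ E] [NormedAddCommGroup F] [NormedSpace ℝ F]
    [NormedAddCommGroup G] [NormedSpace ℝ G] [NormedAddCommGroup X] [NormedSpace ℝ X]
    {g : E × F → G} {u : X → E} {v : X → F} {u' : X →L[ℝ] E} {v' : X →L[ℝ] F} {x : X}
    (hg : DifferentiableAt ℝ g (u x, v x)) (hu : HasFDerivAt u u' x) (hv : HasFDerivAt v v' x) :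
    HasFDerivAt (fun y => g (u y, v y))
      ((fderiv ℝ (fun e => g (e, v x)) (u x)).comp u'
        + (fderiv ℝ (fun b => g (u x, b)) (v x)).comp v') x := by
  have h₁ : HasFDerivAt (fun e => g (e, v x)) _ (u x) :=
    hg.hasFDerivAt.comp (u x) (hasFDerivAt_prodMk_left (u x) (v x))
  have h₂ : HasFDerivAt (fun b => g (u x, b)) _ (v x) :=
    hg.hasFDerivAt.comp (v x) (hasFDerivAt_prodMk_right (u x) (v x))
  rw [h₁.fderiv, h₂.fderiv]
  refine (hg.hasFDerivAt.comp x (hu.prodMk hv)).congr_fderiv ?_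
  ext y
  simp [← map_add]

/-- Chain rule for a function of the state and of the noise-perturbed closed-loop action. -/
theorem hasFDerivAt_closedLoop {S A Θ G : Type*}
    [NormedAddCommGroup S] [NormedSpace ℝ S] [NormedAddCommGroup A] [NormedSpace ℝ A]
    [NormedAddCommGroup Θ] [NormedSpace ℝ Θ] [NormedAddCommGroup G] [NormedSpace ℝ G]
    {g : S × A → G} {pol : Θ × S → A} (hg : Differentiable ℝ g) (hpol : Differentiable ℝ pol)
    {σ : Θ → S} {α : Θ → A} {e : A} (hα : ∀ θ, α θ = pol (θ, σ θ) + e)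
    {σ' : Θ →L[ℝ] S} {θ : Θ} (hσ : HasFDerivAt σ σ' θ) :
    HasFDerivAt (fun p => g (σ p, α p))
      ((fderiv ℝ (fun b => g (σ θ, b)) (α θ)).comp (fderiv ℝ (fun p => pol (p, σ θ)) θ)
        + (fderiv ℝ (fun x => g (x, α θ)) (σ θ)
            + (fderiv ℝ (fun b => g (σ θ, b)) (α θ)).comp
                (fderiv ℝ (fun x => pol (θ, x)) (σ θ))).comp σ') θ := by
  have hα' := (hasFDerivAt_comp_prodMk_partial (hpol (θ, σ θ)) (hasFDerivAt_id θ) hσ).add_const e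
  simp only [id_eq, ← hα] at hα'
  refine (hasFDerivAt_comp_prodMk_partial (hg _) hσ hα').congr_fderiv ?_
  ext y
  simp
  abel

/-- Solution of the linear recursion `x (t + 1) = b t + M t ∘ x t`, `x 0 = 0`, one step. -/
theorem sum_range_succ_prodDesc_comp {S Θ : Type*}
    [NormedAddCommGroup S] [NormedSpace ℝ S] [NormedAddCommGroup Θ] [NormedSpace ℝ Θ]
    (M : ℕ → S →L[ℝ] S) (b : ℕ → Θ →L[ℝ] S) (t : ℕ) :
    ∑ τ ∈ Finset.range (t + 1), (prodDesc M (τ + 1) (t + 1 - 1 - τ)).comp (b τ)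
      = b t + (M t).comp (∑ τ ∈ Finset.range t, (prodDesc M (τ + 1) (t - 1 - τ)).comp (b τ)) := by
  rw [Finset.sum_range_succ, add_comm, ContinuousLinearMap.comp_finsetSum]
  congr 1
  · simp [prodDesc]
  · refine Finset.sum_congr rfl fun τ hτ => ?_
    have hlt := Finset.mem_range.mp hτ
    rw [show t + 1 - 1 - τ = t - 1 - τ + 1 by omega, prodDesc,
      show τ + 1 + (t - 1 - τ) = t by omega, ContinuousLinearMap.comp_assoc]

/-- Full expansion of the return gradient in terms of system Jacobians:
`D_θ R(θ) = Σ_{t=0}^{H−1} [ ∂_a r_t ∘ ∂_θ π_t + (∂_s r_t + ∂_a r_t ∘ ∂_s π_t) ∘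
  Σ_{τ=0}^{t−1} (Π_{j=τ+1}^{t−1} (∂_s f_j + ∂_a f_j ∘ ∂_s π_j)) ∘ ∂_a f_τ ∘ ∂_θ π_τ ]`,
where the product is composed in order of decreasing index `j` and the empty product is the
identity. -/
theorem stmt5
    {S A Θ : Type*}
    [NormedAddCommGroup S] [NormedSpace ℝ S]
    [NormedAddCommGroup A] [NormedSpace ℝ A]
    [NormedAddCommGroup Θ] [NormedSpace ℝ Θ]
    (H : ℕ) (f : S × A → S) (r : S × A → ℝ) (pol : Θ × S → A)
    (hf : Differentiable ℝ f) (hr : Differentiable ℝ r) (hpol : Differentiable ℝ pol)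
    (ε : ℕ → A) (s₀ : S)
    (s : ℕ → Θ → S) (atil : ℕ → Θ → A)
    (hs0 : ∀ θ : Θ, s 0 θ = s₀)
    (hatil : ∀ t : ℕ, ∀ θ : Θ, atil t θ = pol (θ, s t θ) + ε t)
    (hrec : ∀ t < H, ∀ θ : Θ, s (t + 1) θ = f (s t θ, atil t θ))
    (R : Θ → ℝ)
    (hR : ∀ θ : Θ, R θ = ∑ t ∈ Finset.range H, r (s t θ, atil t θ)) :
    ∀ θ : Θ,
      fderiv ℝ R θ =
        ∑ t ∈ Finset.range H,
          ((fderiv ℝ (fun b : A => r (s t θ, b)) (atil t θ)).comp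
              (fderiv ℝ (fun p : Θ => pol (p, s t θ)) θ)
            + (fderiv ℝ (fun x : S => r (x, atil t θ)) (s t θ)
                + (fderiv ℝ (fun b : A => r (s t θ, b)) (atil t θ)).comp
                    (fderiv ℝ (fun x : S => pol (θ, x)) (s t θ))).comp
                (∑ τ ∈ Finset.range t,
                  (prodDesc
                      (fun j : ℕ =>
                        fderiv ℝ (fun x : S => f (x, atil j θ)) (s j θ)
                          + (fderiv ℝ (fun b : A => f (s j θ, b)) (atil j θ)).comp
                              (fderiv ℝ (fun x : S => pol (θ, x)) (s j θ)))
                      (τ + 1) (t - 1 - τ)).comp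
                    ((fderiv ℝ (fun b : A => f (s τ θ, b)) (atil τ θ)).comp
                      (fderiv ℝ (fun p : Θ => pol (p, s τ θ)) θ)))) := by
  intro θ
  have hs : ∀ t ≤ H, HasFDerivAt (s t) (∑ τ ∈ Finset.range t,
      (prodDesc
          (fun j : ℕ =>
            fderiv ℝ (fun x : S => f (x, atil j θ)) (s j θ)
              + (fderiv ℝ (fun b : A => f (s j θ, b)) (atil j θ)).comp
                  (fderiv ℝ (fun x : S => pol (θ, x)) (s j θ)))
          (τ + 1) (t - 1 - τ)).comp
        ((fderiv ℝ (fun b : A => f (s τ θ, b)) (atil τ θ)).comp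
          (fderiv ℝ (fun p : Θ => pol (p, s τ θ)) θ))) θ := by
    intro t
    induction t with
    | zero =>
      intro _
      rw [funext hs0, Finset.sum_range_zero]
      exact hasFDerivAt_const s₀ θ
    | succ t ih =>
      intro ht
      rw [funext (hrec t ht), sum_range_succ_prodDesc_comp]
      exact hasFDerivAt_closedLoop hf hpol (hatil t) (ih (Nat.le_of_succ_le ht))
  rw [funext hR]
  exact (HasFDerivAt.fun_sum fun t ht => hasFDerivAt_closedLoop hr hpol (hatil t)
    (hs t (Finset.mem_range.mp ht).le)).fderiv
end
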